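/- The function p ↦ γ̃_p = ∫₀^∞ log x dν_{α̃(p)}(x), where α̃(p) = 2p/(p + √(p(4 − 3p))), defined on (1/3, 1], has derivative (log 5)/2 at p = 1 within (1/3, 1] (i.e., its left derivative at 1 equals (log 5)/2). -/

import Mathlib

open MeasureTheory Filter Set Topology

noncomputable section

/-- Endpoints (as pairs of nonnegative integers, `(a,b)` representing `a/b`, with `1/0 = ∞`)
of the Stern-Brocot interval obtained from `[0/1, 1/0]` by following the list of choices `w`
(`true` = left sub-interval, `false` = right sub-interval). -/
def sbGo : (ℕ × ℕ) × (ℕ × ℕ) → List Bool → (ℕ × ℕ) × (ℕ × ℕ)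
  | I, [] => I
  | ((a, b), (c, d)), (lft :: w) =>
      if lft then sbGo ((a, b), (a + c, b + d)) w else sbGo ((a + c, b + d), (c, d)) w

/-- The Stern-Brocot interval of rank `w.length` indexed by the list of choices `w`. -/
def sb (w : List Bool) : (ℕ × ℕ) × (ℕ × ℕ) := sbGo ((0, 1), (1, 0)) w

/-- The intersection of a Stern-Brocot interval with `[0, ∞)`, as a subset of `ℝ`. -/
def sbSet : (ℕ × ℕ) × (ℕ × ℕ) → Set ℝ
  | ((a, b), (c, d)) =>
      if d = 0 then Set.Ici ((a : ℝ) / (b : ℝ))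
      else Set.Icc ((a : ℝ) / (b : ℝ)) ((c : ℝ) / (d : ℝ))

/-- `ν` is the measure `ν_α`: a Borel probability measure on `[0,∞)` (viewed as a measure on `ℝ`
giving no mass to `(-∞,0)`) with `ν([0,1]) = 1 - α`, `ν([1,∞)) = α`, and such that for every
Stern-Brocot interval `I` of rank `r ≥ 1`, the left sub-interval of `I` carries a proportion `α`
of the mass of `I` if `r` is odd and `1 - α` if `r` is even. -/
def IsSternBrocotMeasure (α : ℝ) (ν : Measure ℝ) : Prop :=
  IsProbabilityMeasure ν ∧
  ν (Set.Iio 0) = 0 ∧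
  ν (Set.Icc 0 1) = ENNReal.ofReal (1 - α) ∧
  ν (Set.Ici 1) = ENNReal.ofReal α ∧
  ∀ w : List Bool, 1 ≤ w.length →
    ν (sbSet (sb (w ++ [true]))) =
      (if Odd w.length then ENNReal.ofReal α else ENNReal.ofReal (1 - α)) * ν (sbSet (sb w))

/-- The probability that a sequence of independent Bernoulli choices starts with `w`, where choices
are read alternately with their usual and with their reversed orientation. -/
def sbWeight (α : ℝ) : List Bool → ℝ
  | [] => 1
  | b :: w => (if b then 1 - α else α) * sbWeight (1 - α) w

lemma sbWeight_append_singleton (α : ℝ) (w : List Bool) (b : Bool) :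
    sbWeight α (w ++ [b]) =
      (if Odd w.length then (if b then α else 1 - α) else (if b then 1 - α else α)) *
        sbWeight α w := by
  induction w generalizing α with
  | nil => simp [sbWeight]
  | cons c w ih =>
    simp only [List.cons_append, sbWeight, ih, List.length_cons, Nat.odd_add_one]
    by_cases h : Odd w.length <;> cases b <;> cases c <;> simp [h] <;> ring

lemma sbWeight_map_not (α : ℝ) (w : List Bool) :
    sbWeight α (w.map not) = sbWeight (1 - α) w := by
  induction w generalizing α with
  | nil => rfl
  | cons c w ih => cases c <;> simp [sbWeight, ih]

lemma sbGo_append (I : (ℕ × ℕ) × (ℕ × ℕ)) (v w : List Bool) :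
    sbGo I (v ++ w) = sbGo (sbGo I v) w := by
  induction v generalizing I with
  | nil => simp [sbGo]
  | cons c v ih => cases c <;> simp [sbGo, ih]

lemma sb_append_true (w : List Bool) :
    sb (w ++ [true]) = ((sb w).1, (sb w).1 + (sb w).2) := by
  simp only [sb, sbGo_append]
  rfl

lemma sb_append_false (w : List Bool) :
    sb (w ++ [false]) = ((sb w).1 + (sb w).2, (sb w).2) := by
  simp only [sb, sbGo_append]
  rfl

lemma sb_det (w : List Bool) :
    (sb w).1.2 * (sb w).2.1 = (sb w).1.1 * (sb w).2.2 + 1 := by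
  induction w using List.reverseRecOn with
  | nil => rfl
  | append_singleton w b ih =>
    cases b
    · rw [sb_append_false]; simp only [Prod.fst_add, Prod.snd_add]; linarith
    · rw [sb_append_true]; simp only [Prod.fst_add, Prod.snd_add]; linarith

lemma sb_fst_snd_pos (w : List Bool) : 0 < (sb w).1.2 := by
  have := sb_det w
  by_contra! h
  simp [Nat.le_zero.mp h] at this

lemma sb_snd_fst_pos (w : List Bool) : 0 < (sb w).2.1 := by
  have := sb_det w
  by_contra! h
  simp [Nat.le_zero.mp h] at this

lemma sb_cons_false_map_not (w : List Bool) :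
    sb (false :: w.map not) = (((sb w).2.2 + (sb w).2.1, (sb w).2.1),
      ((sb w).1.2 + (sb w).1.1, (sb w).1.1)) := by
  induction w using List.reverseRecOn with
  | nil => rfl
  | append_singleton w b ih =>
    rw [List.map_append, ← List.cons_append]
    cases b
    · simp only [List.map_cons, List.map_nil, Bool.not_false, sb_append_true, sb_append_false, ih]
      ext <;> simp <;> ring
    · simp only [List.map_cons, List.map_nil, Bool.not_true, sb_append_true, sb_append_false, ih]
      ext <;> simp <;> ring

lemma sb_cons_true_map_not (w : List Bool) :
    sb (true :: w.map not) = (((sb w).2.2, (sb w).2.2 + (sb w).2.1),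
      ((sb w).1.2, (sb w).1.2 + (sb w).1.1)) := by
  induction w using List.reverseRecOn with
  | nil => rfl
  | append_singleton w b ih =>
    rw [List.map_append, ← List.cons_append]
    cases b
    · simp only [List.map_cons, List.map_nil, Bool.not_false, sb_append_true, sb_append_false, ih]
      ext <;> simp <;> ring
    · simp only [List.map_cons, List.map_nil, Bool.not_true, sb_append_true, sb_append_false, ih]
      ext <;> simp <;> ring

lemma mem_sbSet_sb {w : List Bool} {x : ℝ} :
    x ∈ sbSet (sb w) ↔ ((sb w).1.1 : ℝ) ≤ (sb w).1.2 * x ∧ ((sb w).2.2 : ℝ) * x ≤ (sb w).2.1 := by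
  have hb : (0 : ℝ) < (sb w).1.2 := by exact_mod_cast sb_fst_snd_pos w
  generalize sb w = I at hb ⊢
  obtain ⟨⟨a, b⟩, c, d⟩ := I
  simp only at hb
  rcases Nat.eq_zero_or_pos d with rfl | hd
  · simp [sbSet, div_le_iff₀' hb]
  · have hd' : (0 : ℝ) < d := by exact_mod_cast hd
    simp [sbSet, hd.ne', div_le_iff₀' hb, le_div_iff₀' hd']

lemma measurableSet_sbSet (I : (ℕ × ℕ) × (ℕ × ℕ)) : MeasurableSet (sbSet I) := by
  obtain ⟨⟨a, b⟩, c, d⟩ := I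
  simp only [sbSet]
  split_ifs
  exacts [measurableSet_Ici, measurableSet_Icc]

/-- Every positive rational is a mediant. -/
lemma exists_sb_mediant {p q : ℕ} (hp : 0 < p) (hq : 0 < q) (h : p.Coprime q) :
    ∃ w, (sb w).1 + (sb w).2 = (p, q) := by
  induction hn : p + q using Nat.strong_induction_on generalizing p q with
  | _ n ih =>
    rcases lt_trichotomy p q with hlt | rfl | hlt
    · obtain ⟨w, hw⟩ := ih q (by omega) (p := q - p) (q := p) (by omega) hp
        ((Nat.coprime_sub_self_left hlt.le).2 h.symm) (by omega)
      refine ⟨true :: w.map not, ?_⟩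
      rw [sb_cons_true_map_not]
      simp only [Prod.ext_iff, Prod.fst_add, Prod.snd_add] at hw ⊢
      omega
    · have : p = 1 := by simpa using h
      subst this
      exact ⟨[], rfl⟩
    · obtain ⟨w, hw⟩ := ih p (by omega) (p := q) (q := p - q) hq (by omega)
        ((Nat.coprime_sub_self_right hlt.le).2 h.symm) (by omega)
      refine ⟨false :: w.map not, ?_⟩
      rw [sb_cons_false_map_not]
      simp only [Prod.ext_iff, Prod.fst_add, Prod.snd_add] at hw ⊢
      omega

lemma sb_cast_det (w : List Bool) :
    ((sb w).1.2 : ℝ) * (sb w).2.1 = (sb w).1.1 * (sb w).2.2 + 1 := by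
  exact_mod_cast sb_det w

/-- The mediant of the endpoints of a Stern-Brocot interval. -/
def sbMediant (w : List Bool) : ℝ :=
  (((sb w).1.1 : ℝ) + (sb w).2.1) / ((sb w).1.2 + (sb w).2.2)

lemma sb_denom_pos (w : List Bool) : (0 : ℝ) < (sb w).1.2 + (sb w).2.2 := by
  have := sb_fst_snd_pos w
  positivity

lemma le_of_le_sbMediant {w : List Bool} {x : ℝ}
    (h : (((sb w).1.2 : ℝ) + (sb w).2.2) * x ≤ (sb w).1.1 + (sb w).2.1) :
    ((sb w).2.2 : ℝ) * x ≤ (sb w).2.1 := by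
  by_contra! hx
  nlinarith [mul_lt_mul_of_pos_left hx (sb_denom_pos w), sb_cast_det w,
    mul_le_mul_of_nonneg_left h (Nat.cast_nonneg (α := ℝ) (sb w).2.2)]

lemma le_of_sbMediant_le {w : List Bool} {x : ℝ}
    (h : ((sb w).1.1 : ℝ) + (sb w).2.1 ≤ ((sb w).1.2 + (sb w).2.2) * x) :
    ((sb w).1.1 : ℝ) ≤ (sb w).1.2 * x := by
  by_contra! hx
  nlinarith [mul_lt_mul_of_pos_left hx (sb_denom_pos w), sb_cast_det w,
    mul_le_mul_of_nonneg_left h (Nat.cast_nonneg (α := ℝ) (sb w).1.2)]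

lemma mem_sbSet_append_true {w : List Bool} {x : ℝ} :
    x ∈ sbSet (sb (w ++ [true])) ↔ ((sb w).1.1 : ℝ) ≤ (sb w).1.2 * x ∧ x ≤ sbMediant w := by
  rw [mem_sbSet_sb, sb_append_true, sbMediant, le_div_iff₀' (sb_denom_pos w)]
  simp

lemma mem_sbSet_append_false {w : List Bool} {x : ℝ} :
    x ∈ sbSet (sb (w ++ [false])) ↔ sbMediant w ≤ x ∧ ((sb w).2.2 : ℝ) * x ≤ (sb w).2.1 := by
  rw [mem_sbSet_sb, sb_append_false, sbMediant, div_le_iff₀' (sb_denom_pos w)]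
  simp

lemma sbSet_union (w : List Bool) :
    sbSet (sb (w ++ [true])) ∪ sbSet (sb (w ++ [false])) = sbSet (sb w) := by
  ext x
  rw [mem_union, mem_sbSet_append_true, mem_sbSet_append_false, mem_sbSet_sb]
  constructor
  · rintro (⟨h1, h2⟩ | ⟨h1, h2⟩)
    · exact ⟨h1, le_of_le_sbMediant ((le_div_iff₀' (sb_denom_pos w)).1 h2)⟩
    · exact ⟨le_of_sbMediant_le ((div_le_iff₀' (sb_denom_pos w)).1 h1), h2⟩
  · rintro ⟨h1, h2⟩
    rcases le_total x (sbMediant w) with h | h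
    exacts [Or.inl ⟨h1, h⟩, Or.inr ⟨h, h2⟩]

lemma sbSet_inter (w : List Bool) :
    sbSet (sb (w ++ [true])) ∩ sbSet (sb (w ++ [false])) = {sbMediant w} := by
  ext x
  rw [mem_inter_iff, mem_sbSet_append_true, mem_sbSet_append_false, mem_singleton_iff]
  constructor
  · rintro ⟨⟨-, h1⟩, h2, -⟩
    exact le_antisymm h1 h2
  · rintro rfl
    exact ⟨⟨le_of_sbMediant_le ((div_le_iff₀' (sb_denom_pos w)).1 le_rfl), le_rfl⟩, le_rfl,
      le_of_le_sbMediant ((le_div_iff₀' (sb_denom_pos w)).1 le_rfl)⟩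

lemma measureReal_sbSet_add (ν : Measure ℝ) [IsFiniteMeasure ν] (w : List Bool) :
    ν.real (sbSet (sb (w ++ [true]))) + ν.real (sbSet (sb (w ++ [false]))) =
      ν.real (sbSet (sb w)) + ν.real {sbMediant w} := by
  rw [← sbSet_union w, ← sbSet_inter w,
    measureReal_union_add_inter (measurableSet_sbSet (sb (w ++ [false])))]

/-- The measure `ν` gives no mass to `(-∞, 0]`, and mass `sbWeight α w` to the Stern-Brocot
interval indexed by `w`. -/
def IsSternBrocotLaw (α : ℝ) (ν : Measure ℝ) : Prop :=
  ν (Iic 0) = 0 ∧ ∀ w, ν.real (sbSet (sb w)) = sbWeight α w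

section

variable {α : ℝ} {ν : Measure ℝ}

lemma IsSternBrocotMeasure.measureReal_append_true (h : IsSternBrocotMeasure α ν)
    (hα : α ∈ Icc (0 : ℝ) 1) {w : List Bool} (hw : 1 ≤ w.length) :
    ν.real (sbSet (sb (w ++ [true]))) =
      (if Odd w.length then α else 1 - α) * ν.real (sbSet (sb w)) := by
  rw [Measure.real, h.2.2.2.2 w hw, ENNReal.toReal_mul, Measure.real]
  congr 1
  split_ifs
  · exact ENNReal.toReal_ofReal hα.1
  · exact ENNReal.toReal_ofReal (by linarith [hα.2])

lemma IsSternBrocotMeasure.measureReal_left_endpoint_le (h : IsSternBrocotMeasure α ν)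
    (hα : α ∈ Icc (0 : ℝ) 1) (n : ℕ) {w : List Bool} (hw : 1 ≤ w.length) :
    ν.real {((sb w).1.1 : ℝ) / (sb w).1.2} ≤ (1 / 2) ^ n * ν.real (sbSet (sb w)) := by
  have := h.1
  induction n generalizing w with
  | zero =>
    rw [pow_zero, one_mul]
    refine measureReal_mono ?_
    have hb : (0 : ℝ) < (sb w).1.2 := by exact_mod_cast sb_fst_snd_pos w
    have := sb_cast_det w
    rw [singleton_subset_iff, mem_sbSet_sb, mul_div_cancel₀ _ hb.ne', ← mul_div_assoc,
      div_le_iff₀ hb]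
    exact ⟨le_rfl, by linarith⟩
  | succ n ih =>
    have key := ih (w := w ++ [true] ++ [true]) (by simp)
    rw [h.measureReal_append_true hα (by simp), h.measureReal_append_true hα hw,
      sb_append_true, sb_append_true] at key
    refine key.trans ?_
    rw [pow_succ, mul_assoc, ← mul_assoc (ite _ _ _)]
    gcongr
    simp only [List.length_append, List.length_singleton, Nat.odd_add_one]
    split_ifs <;> first | contradiction | nlinarith [sq_nonneg (2 * α - 1)]

lemma IsSternBrocotMeasure.measureReal_left_endpoint (h : IsSternBrocotMeasure α ν)
    (hα : α ∈ Icc (0 : ℝ) 1) {w : List Bool} (hw : 1 ≤ w.length) :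
    ν.real {((sb w).1.1 : ℝ) / (sb w).1.2} = 0 := by
  refine le_antisymm ?_ measureReal_nonneg
  have : Tendsto (fun n : ℕ => (1 / 2 : ℝ) ^ n * ν.real (sbSet (sb w))) atTop (𝓝 0) := by
    simpa using (tendsto_pow_atTop_nhds_zero_of_lt_one (r := (1 / 2 : ℝ))
      (by norm_num) (by norm_num)).mul_const (ν.real (sbSet (sb w)))
  exact ge_of_tendsto' this fun n => h.measureReal_left_endpoint_le hα n hw

lemma IsSternBrocotMeasure.isSternBrocotLaw (h : IsSternBrocotMeasure α ν)
    (hα : α ∈ Icc (0 : ℝ) 1) : IsSternBrocotLaw α ν := by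
  have := h.1
  constructor
  · have h0 := h.measureReal_left_endpoint hα (w := [true]) le_rfl
    rw [measureReal_eq_zero_iff] at h0
    rw [← Iio_insert, insert_eq]
    exact measure_union_null (by simpa [sb, sbGo] using h0) h.2.1
  intro w
  induction w using List.reverseRecOn with
  | nil =>
    have : sbSet (sb []) = (Iio 0)ᶜ := by simp [sb, sbGo, sbSet]
    rw [this, measureReal_compl measurableSet_Iio, Measure.real, Measure.real, h.2.1]
    simp [sbWeight]
  | append_singleton w b ih =>
    rcases Nat.eq_zero_or_pos w.length with hw | hw
    · obtain rfl := List.length_eq_zero_iff.1 hw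
      cases b
      · have : sbSet (sb ([] ++ [false])) = Ici 1 := by simp [sb, sbGo, sbSet]
        rw [this, Measure.real, h.2.2.2.1, ENNReal.toReal_ofReal hα.1]
        simp [sbWeight]
      · have : sbSet (sb ([] ++ [true])) = Icc 0 1 := by simp [sb, sbGo, sbSet]
        rw [this, Measure.real, h.2.2.1, ENNReal.toReal_ofReal (by linarith [hα.2])]
        simp [sbWeight]
    · have ht := h.measureReal_append_true hα hw
      cases b
      · have hm := h.measureReal_left_endpoint hα (w := w ++ [false]) (by simp)
        rw [sb_append_false] at hm
        have hadd := measureReal_sbSet_add ν w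
        simp only [Prod.fst_add, Prod.snd_add, Nat.cast_add] at hm
        rw [sbMediant, hm, ht, ih] at hadd
        rw [sbWeight_append_singleton]
        split_ifs at hadd ⊢ <;> simp at * <;> linarith
      · rw [ht, sbWeight_append_singleton, ih]
        simp

end

/-- The half-line to the right of the Stern-Brocot interval indexed by `w`. -/
def sbUpper (w : List Bool) : Set ℝ := {x | ((sb w).2.1 : ℝ) < (sb w).2.2 * x}

lemma sbUpper_append_true (w : List Bool) : sbUpper (w ++ [true]) = Ioi (sbMediant w) := by
  ext x
  rw [sbUpper, mem_ofPred_eq, sb_append_true, mem_Ioi, sbMediant, div_lt_iff₀' (sb_denom_pos w)]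
  simp

lemma sbUpper_append_false (w : List Bool) : sbUpper (w ++ [false]) = sbUpper w := by
  rw [sbUpper, sb_append_false, sbUpper]

lemma Ici_sbMediant (w : List Bool) :
    Ici (sbMediant w) = sbSet (sb (w ++ [false])) ∪ sbUpper w := by
  ext x
  rw [mem_union, mem_sbSet_append_false, mem_Ici, sbUpper, mem_ofPred_eq]
  constructor
  · intro h
    rcases le_or_gt (((sb w).2.2 : ℝ) * x) (sb w).2.1 with h' | h'
    exacts [Or.inl ⟨h, h'⟩, Or.inr h']
  · rintro (⟨h, -⟩ | h)
    · exact h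
    · by_contra! h'
      exact absurd (le_of_le_sbMediant ((le_div_iff₀' (sb_denom_pos w)).1 h'.le)) (not_le.2 h)

lemma measurableSet_sbUpper (w : List Bool) : MeasurableSet (sbUpper w) :=
  measurableSet_lt measurable_const (measurable_const.mul measurable_id)

namespace IsSternBrocotLaw

variable {α : ℝ} {μ ν : Measure ℝ}

lemma measureReal_sbMediant [IsFiniteMeasure ν] (h : IsSternBrocotLaw α ν) (w : List Bool) :
    ν.real {sbMediant w} = 0 := by
  have := measureReal_sbSet_add ν w
  rw [h.2, h.2, h.2, sbWeight_append_singleton, sbWeight_append_singleton] at this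
  split_ifs at this <;> simp at * <;> linarith

lemma measureReal_Ioi_sbMediant [IsFiniteMeasure ν] (h : IsSternBrocotLaw α ν) (w : List Bool) :
    ν.real (Ioi (sbMediant w)) = sbWeight α (w ++ [false]) + ν.real (sbUpper w) := by
  have h1 : ν.real (Ici (sbMediant w)) = ν.real (Ioi (sbMediant w)) := by
    rw [← Ioi_insert, insert_eq, measureReal_union (by simp) measurableSet_Ioi,
      h.measureReal_sbMediant, zero_add]
  rw [← h1, Ici_sbMediant, measureReal_union _ (measurableSet_sbUpper w), h.2]
  refine Set.disjoint_left.2 fun x hx hx' => ?_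
  exact absurd (mem_sbSet_append_false.1 hx).2 (not_le.2 hx')

lemma measureReal_sbUpper_eq [IsFiniteMeasure μ] [IsFiniteMeasure ν] (hμ : IsSternBrocotLaw α μ)
    (hν : IsSternBrocotLaw α ν) (w : List Bool) : μ.real (sbUpper w) = ν.real (sbUpper w) := by
  induction w using List.reverseRecOn with
  | nil =>
    have : sbUpper [] = ∅ := by
      ext x
      simp [sbUpper, sb, sbGo]
    simp [this]
  | append_singleton w b ih =>
    cases b
    · rw [sbUpper_append_false, ih]
    · rw [sbUpper_append_true, hμ.measureReal_Ioi_sbMediant, hν.measureReal_Ioi_sbMediant, ih]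

lemma eq [IsProbabilityMeasure μ] [IsProbabilityMeasure ν] (hμ : IsSternBrocotLaw α μ)
    (hν : IsSternBrocotLaw α ν) : μ = ν := by
  refine ext_of_generate_finite _ (Real.borel_eq_generateFrom_Ioi_rat ▸
    BorelSpace.measurable_eq) Real.isPiSystem_Ioi_rat ?_ (by simp)
  intro s hs
  obtain ⟨q, rfl⟩ := mem_iUnion.1 hs
  rcases le_or_gt q 0 with hq | hq
  · have aux {ρ : Measure ℝ} [IsProbabilityMeasure ρ] (hρ : IsSternBrocotLaw α ρ) :
        ρ (Ioi (q : ℝ)) = 1 := by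
      rw [← compl_Iic, prob_compl_eq_one_iff measurableSet_Iic]
      exact measure_mono_null (Iic_subset_Iic.2 (by exact_mod_cast hq)) hρ.1
    rw [aux hμ, aux hν]
  · obtain ⟨w, hw⟩ := exists_sb_mediant (p := q.num.natAbs) (q := q.den)
      (by have := Rat.num_pos.2 hq; omega) q.den_pos q.reduced
    have hqw : (q : ℝ) = sbMediant w := by
      have h1 : ((sb w).1.1 : ℝ) + (sb w).2.1 = (q.num.natAbs : ℝ) := by
        exact_mod_cast congrArg Prod.fst hw
      have h2 : ((sb w).1.2 : ℝ) + (sb w).2.2 = (q.den : ℝ) := by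
        exact_mod_cast congrArg Prod.snd hw
      rw [sbMediant, h1, h2, Nat.cast_natAbs, abs_of_pos (Rat.num_pos.2 hq), Rat.cast_def]
    rw [hqw, ← measureReal_eq_measureReal_iff, hμ.measureReal_Ioi_sbMediant,
      hν.measureReal_Ioi_sbMediant, hμ.measureReal_sbUpper_eq hν]

/-- The image of a Stern-Brocot law by the random map equal to `x ↦ 1 + x⁻¹` with probability `α`
and to `x ↦ (1 + x)⁻¹` with probability `1 - α`. -/
def step (α : ℝ) (ν : Measure ℝ) : Measure ℝ :=
  ENNReal.ofReal α • ν.map (fun x => 1 + x⁻¹) + ENNReal.ofReal (1 - α) • ν.map (fun x => (1 + x)⁻¹)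

lemma ae_pos (h : IsSternBrocotLaw α ν) : ∀ᵐ x ∂ν, 0 < x := by
  rw [ae_iff]
  simpa [Iic] using h.1

lemma measurable_one_add_inv : Measurable fun x : ℝ => 1 + x⁻¹ := by fun_prop

lemma measurable_inv_one_add : Measurable fun x : ℝ => (1 + x)⁻¹ := by fun_prop

lemma isProbabilityMeasure_step [IsProbabilityMeasure ν] (hα : α ∈ Icc (0 : ℝ) 1) :
    IsProbabilityMeasure (step α ν) := by
  constructor
  rw [step, Measure.add_apply, Measure.smul_apply, Measure.smul_apply,
    Measure.map_apply measurable_one_add_inv .univ, Measure.map_apply measurable_inv_one_add .univ]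
  simp only [preimage_univ, measure_univ, smul_eq_mul, mul_one]
  rw [← ENNReal.ofReal_add hα.1 (by linarith [hα.2])]
  simp

lemma measureReal_step [IsFiniteMeasure ν] (hα : α ∈ Icc (0 : ℝ) 1) {s : Set ℝ}
    (hs : MeasurableSet s) :
    (step α ν).real s =
      α * ν.real {x | 1 + x⁻¹ ∈ s} + (1 - α) * ν.real {x | (1 + x)⁻¹ ∈ s} := by
  rw [Measure.real, step, Measure.add_apply, Measure.smul_apply, Measure.smul_apply,
    Measure.map_apply measurable_one_add_inv hs, Measure.map_apply measurable_inv_one_add hs,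
    smul_eq_mul, smul_eq_mul, ENNReal.toReal_add, ENNReal.toReal_mul, ENNReal.toReal_mul,
    ENNReal.toReal_ofReal hα.1, ENNReal.toReal_ofReal (by linarith [hα.2])]
  · rfl
  · exact ENNReal.mul_ne_top ENNReal.ofReal_ne_top (measure_ne_top _ _)
  · exact ENNReal.mul_ne_top ENNReal.ofReal_ne_top (measure_ne_top _ _)

lemma isSternBrocotLaw_step [IsProbabilityMeasure ν] (h : IsSternBrocotLaw α ν)
    (hα : α ∈ Icc (0 : ℝ) 1) : IsSternBrocotLaw α (step α ν) := by
  have := isProbabilityMeasure_step (ν := ν) hα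
  have null {s : Set ℝ} (hs : ∀ x, 0 < x → x ∉ s) : ν.real s = 0 := by
    rw [measureReal_eq_zero_iff]
    exact measure_mono_null (fun x hx => not_lt.1 fun hx' => hs x hx' hx) h.1
  have congr {s t : Set ℝ} (hs : ∀ x, 0 < x → (x ∈ s ↔ x ∈ t)) : ν.real s = ν.real t :=
    measureReal_congr (h.ae_pos.mono fun x hx => propext (hs x hx))
  constructor
  · rw [← measureReal_eq_zero_iff, measureReal_step hα measurableSet_Iic, null, null]
    · simp
    · intro x hx
      have : 0 < (1 + x)⁻¹ := by positivity
      simpa using this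
    · intro x hx
      have : 0 < 1 + x⁻¹ := by positivity
      simpa using this
  rintro (_ | ⟨b, v⟩)
  · have : sbSet (sb []) = Ici 0 := by simp [sb, sbGo, sbSet]
    rw [measureReal_step hα (measurableSet_sbSet _), this,
      congr (s := {x | 1 + x⁻¹ ∈ _}) (t := univ), congr (s := {x | (1 + x)⁻¹ ∈ _}) (t := univ)]
    · simp [sbWeight]
    · intro x hx
      rw [mem_ofPred_eq, mem_Ici]
      simp only [mem_univ, iff_true]
      positivity
    · intro x hx
      rw [mem_ofPred_eq, mem_Ici]
      simp only [mem_univ, iff_true]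
      positivity
  obtain ⟨w, rfl⟩ : ∃ w : List Bool, w.map not = v := ⟨v.map not, by simp [Function.comp_def]⟩
  have hb : (0 : ℝ) < (sb w).1.2 := by exact_mod_cast sb_fst_snd_pos w
  have hc : (0 : ℝ) < (sb w).2.1 := by exact_mod_cast sb_snd_fst_pos w
  have ha : (0 : ℝ) ≤ (sb w).1.1 := Nat.cast_nonneg _
  have hd : (0 : ℝ) ≤ (sb w).2.2 := Nat.cast_nonneg _
  rw [sbWeight, sbWeight_map_not, sub_sub_cancel, measureReal_step hα (measurableSet_sbSet _)]
  cases b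
  · rw [congr (s := {x | 1 + x⁻¹ ∈ _}) (t := sbSet (sb w)),
      null (s := {x | (1 + x)⁻¹ ∈ _}), h.2]
    · simp
    · intro x hx
      have hx1 : (1 + x)⁻¹ < 1 := inv_lt_one_of_one_lt₀ (by linarith)
      rw [mem_ofPred_eq, mem_sbSet_sb, sb_cons_false_map_not]
      push_cast
      rintro ⟨h1, -⟩
      nlinarith
    · intro x hx
      rw [mem_ofPred_eq, mem_sbSet_sb, mem_sbSet_sb, sb_cons_false_map_not]
      push_cast
      rw [mul_add, mul_add, ← div_eq_mul_inv, ← div_eq_mul_inv, mul_one, mul_one,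
        add_comm ((sb w).2.1 : ℝ), add_le_add_iff_right, add_comm ((sb w).1.1 : ℝ),
        add_le_add_iff_right, le_div_iff₀ hx, div_le_iff₀ hx]
      exact and_comm
  · rw [null (s := {x | 1 + x⁻¹ ∈ _}), congr (s := {x | (1 + x)⁻¹ ∈ _}) (t := sbSet (sb w)), h.2]
    · simp
    · intro x hx
      have hx1 : 0 < 1 + x := by linarith
      rw [mem_ofPred_eq, mem_sbSet_sb, mem_sbSet_sb, sb_cons_true_map_not]
      push_cast
      rw [← div_eq_mul_inv, ← div_eq_mul_inv, le_div_iff₀ hx1, div_le_iff₀ hx1, mul_add, mul_add,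
        mul_one, mul_one, add_le_add_iff_left, add_le_add_iff_left]
      exact and_comm
    · intro x hx
      have hx1 : 0 < x⁻¹ := by positivity
      rw [mem_ofPred_eq, mem_sbSet_sb, sb_cons_true_map_not]
      push_cast
      rintro ⟨-, h2⟩
      nlinarith [mul_nonneg ha hx1.le, mul_pos hb hx1]

/-- A Stern-Brocot law is stationary. -/
lemma step_eq [IsProbabilityMeasure ν] (h : IsSternBrocotLaw α ν) (hα : α ∈ Icc (0 : ℝ) 1) :
    step α ν = ν :=
  have := isProbabilityMeasure_step (ν := ν) hα
  (h.isSternBrocotLaw_step hα).eq h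

lemma lintegral_eq [IsProbabilityMeasure ν] (h : IsSternBrocotLaw α ν) (hα : α ∈ Icc (0 : ℝ) 1)
    {f : ℝ → ENNReal} (hf : Measurable f) :
    ∫⁻ x, f x ∂ν = ENNReal.ofReal α * ∫⁻ x, f (1 + x⁻¹) ∂ν +
      ENNReal.ofReal (1 - α) * ∫⁻ x, f ((1 + x)⁻¹) ∂ν := by
  conv_lhs => rw [← h.step_eq hα, step]
  rw [lintegral_add_measure, lintegral_smul_measure, lintegral_smul_measure,
    lintegral_map hf measurable_one_add_inv, lintegral_map hf measurable_inv_one_add,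
    smul_eq_mul, smul_eq_mul]

lemma integral_eq [IsProbabilityMeasure ν] (h : IsSternBrocotLaw α ν) (hα : α ∈ Icc (0 : ℝ) 1)
    {f : ℝ → ℝ} (hf : Measurable f) (h₁ : Integrable (fun x => f (1 + x⁻¹)) ν)
    (h₂ : Integrable (fun x => f ((1 + x)⁻¹)) ν) :
    ∫ x, f x ∂ν = α * ∫ x, f (1 + x⁻¹) ∂ν + (1 - α) * ∫ x, f ((1 + x)⁻¹) ∂ν := by
  have hm {g : ℝ → ℝ} (hg : Measurable g) (hi : Integrable (fun x => f (g x)) ν) :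
      Integrable f (ν.map g) :=
    (integrable_map_measure hf.aestronglyMeasurable hg.aemeasurable).2 hi
  conv_lhs => rw [← h.step_eq hα, step]
  rw [integral_add_measure ((hm measurable_one_add_inv h₁).smul_measure ENNReal.ofReal_ne_top)
      ((hm measurable_inv_one_add h₂).smul_measure ENNReal.ofReal_ne_top),
    integral_smul_measure, integral_smul_measure,
    integral_map measurable_one_add_inv.aemeasurable hf.aestronglyMeasurable,
    integral_map measurable_inv_one_add.aemeasurable hf.aestronglyMeasurable,
    ENNReal.toReal_ofReal hα.1, ENNReal.toReal_ofReal (by linarith [hα.2]), smul_eq_mul,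
    smul_eq_mul]

lemma integral_le [IsProbabilityMeasure ν] (h : IsSternBrocotLaw α ν) (hα : α ∈ Icc (0 : ℝ) 1)
    {f g₁ g₂ : ℝ → ℝ} (hf : Measurable f) (hf0 : ∀ x, 0 ≤ f x) (hi₁ : Integrable g₁ ν)
    (hi₂ : Integrable g₂ ν) (h₁ : ∀ x, 0 < x → f (1 + x⁻¹) ≤ g₁ x)
    (h₂ : ∀ x, 0 < x → f ((1 + x)⁻¹) ≤ g₂ x) :
    ∫ x, f x ∂ν ≤ α * ∫ x, g₁ x ∂ν + (1 - α) * ∫ x, g₂ x ∂ν := by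
  have hj₁ : Integrable (fun x => f (1 + x⁻¹)) ν := by
    refine hi₁.mono' (hf.comp measurable_one_add_inv).aestronglyMeasurable ?_
    filter_upwards [h.ae_pos] with x hx
    rw [Real.norm_of_nonneg (hf0 _)]
    exact h₁ x hx
  have hj₂ : Integrable (fun x => f ((1 + x)⁻¹)) ν := by
    refine hi₂.mono' (hf.comp measurable_inv_one_add).aestronglyMeasurable ?_
    filter_upwards [h.ae_pos] with x hx
    rw [Real.norm_of_nonneg (hf0 _)]
    exact h₂ x hx
  rw [h.integral_eq hα hf hj₁ hj₂]
  have := hα.1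
  have : 0 ≤ 1 - α := by linarith [hα.2]
  gcongr ?_ * ?_ + ?_ * ?_
  · exact integral_mono_ae hj₁ hi₁ (h.ae_pos.mono h₁)
  · exact integral_mono_ae hj₂ hi₂ (h.ae_pos.mono h₂)

/-- The truncated moments of order `1` and `-1` are bounded independently of the truncation. -/
lemma lintegral_min_le [IsProbabilityMeasure ν] (h : IsSternBrocotLaw α ν)
    (hα : α ∈ Icc (3 / 4 : ℝ) 1) (N : ℕ) :
    ∫⁻ x, min (ENNReal.ofReal x) N ∂ν ≤ 5 ∧ ∫⁻ x, min (ENNReal.ofReal x⁻¹) N ∂ν ≤ 5 := by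
  have hα' : α ∈ Icc (0 : ℝ) 1 := ⟨by linarith [hα.1], hα.2⟩
  have hfin (f : ℝ → ENNReal) : ∫⁻ x, min (f x) N ∂ν ≠ ⊤ := by
    refine ne_top_of_le_ne_top (ENNReal.natCast_ne_top N) ?_
    calc ∫⁻ x, min (f x) N ∂ν ≤ ∫⁻ _, (N : ENNReal) ∂ν := lintegral_mono fun x => min_le_right _ _
      _ = N := by simp
  have hone {f : ℝ → ENNReal} (hf : ∀ x, 0 < x → f x ≤ 1) : ∫⁻ x, min (f x) N ∂ν ≤ 1 := by
    calc ∫⁻ x, min (f x) N ∂ν ≤ ∫⁻ _, 1 ∂ν :=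
          lintegral_mono_ae (h.ae_pos.mono fun x hx => (min_le_left _ _).trans (hf x hx))
      _ = 1 := by simp
  have hadd {f g : ℝ → ENNReal} (hfg : ∀ x, f x ≤ 1 + g x) :
      ∫⁻ x, min (f x) N ∂ν ≤ 1 + ∫⁻ x, min (g x) N ∂ν := by
    calc ∫⁻ x, min (f x) N ∂ν ≤ ∫⁻ x, (1 + min (g x) N) ∂ν := by
          refine lintegral_mono fun x => ?_
          rw [min_def (g x)]
          split_ifs
          · exact (min_le_left _ _).trans (hfg x)
          · exact (min_le_right _ _).trans le_add_self
      _ = 1 + ∫⁻ x, min (g x) N ∂ν := by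
          rw [lintegral_add_left measurable_const]
          simp
  have ha : ∫⁻ x, min (ENNReal.ofReal x) N ∂ν ≤
      1 * (1 + ∫⁻ x, min (ENNReal.ofReal x⁻¹) N ∂ν) + 1 * 1 := by
    rw [h.lintegral_eq hα' (by fun_prop)]
    gcongr
    · simpa using hα.2
    · exact hadd fun x => by simpa using ENNReal.ofReal_add_le (p := 1) (q := x⁻¹)
    · simpa using hα'.1
    · refine hone fun x hx => ?_
      rw [ENNReal.ofReal_le_one]
      exact inv_le_one_of_one_le₀ (by linarith)
  have hb : ∫⁻ x, min (ENNReal.ofReal x⁻¹) N ∂ν ≤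
      1 * 1 + ENNReal.ofReal (1 / 4) * (1 + ∫⁻ x, min (ENNReal.ofReal x) N ∂ν) := by
    rw [h.lintegral_eq hα' (by fun_prop)]
    gcongr
    · simpa using hα.2
    · refine hone fun x hx => ?_
      rw [ENNReal.ofReal_le_one]
      exact inv_le_one_of_one_le₀ (by linarith [inv_pos.2 hx])
    · linarith [hα.1]
    · refine hadd fun x => ?_
      rw [inv_inv]
      simpa using ENNReal.ofReal_add_le (p := 1) (q := x)
  have hA := hfin fun x => ENNReal.ofReal x
  have hB := hfin fun x => ENNReal.ofReal x⁻¹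
  lift ∫⁻ x, min (ENNReal.ofReal x) N ∂ν to NNReal using hA with A
  lift ∫⁻ x, min (ENNReal.ofReal x⁻¹) N ∂ν to NNReal using hB with B
  have hq : ENNReal.ofReal (1 / 4) = ((1 / 4 : NNReal) : ENNReal) := by
    rw [← ENNReal.ofReal_coe_nnreal]
    simp
  rw [hq] at hb
  have ha' : (A : ℝ) ≤ 1 * (1 + B) + 1 * 1 := by exact_mod_cast ha
  have hb' : (B : ℝ) ≤ 1 * 1 + (1 / 4) * (1 + A) := by exact_mod_cast hb
  have h5 : A ≤ 5 ∧ B ≤ 5 := by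
    rw [← NNReal.coe_le_coe, ← NNReal.coe_le_coe]
    push_cast
    constructor <;> linarith
  exact_mod_cast h5

lemma integrable_of_lintegral_min_le {ν : Measure ℝ} {f : ℝ → ℝ} (hf : Measurable f)
    (hf0 : ∀ᵐ x ∂ν, 0 ≤ f x) {C : ENNReal} (hC : C ≠ ⊤)
    (h : ∀ N : ℕ, ∫⁻ x, min (ENNReal.ofReal (f x)) N ∂ν ≤ C) : Integrable f ν := by
  have hlim : Tendsto (fun N : ℕ => ∫⁻ x, min (ENNReal.ofReal (f x)) N ∂ν) atTop
      (𝓝 (∫⁻ x, ENNReal.ofReal (f x) ∂ν)) := by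
    refine lintegral_tendsto_of_tendsto_of_monotone (fun N => by fun_prop) (.of_forall fun x => ?_)
      (.of_forall fun x => ?_)
    · intro m n hmn
      dsimp only
      gcongr
    · refine tendsto_const_nhds.congr' ?_
      obtain ⟨n, hn⟩ := ENNReal.exists_nat_gt (ENNReal.ofReal_ne_top (r := f x))
      filter_upwards [eventually_ge_atTop n] with m hm
      rw [min_eq_left (hn.le.trans (by exact_mod_cast hm))]
  refine ⟨hf.aestronglyMeasurable, ?_⟩
  rw [hasFiniteIntegral_iff_ofReal hf0]
  exact (le_of_tendsto' hlim h).trans_lt hC.lt_top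

lemma integrable_id [IsProbabilityMeasure ν] (h : IsSternBrocotLaw α ν)
    (hα : α ∈ Icc (3 / 4 : ℝ) 1) : Integrable (fun x => x) ν :=
  integrable_of_lintegral_min_le measurable_id (h.ae_pos.mono fun _ hx => hx.le)
    (C := 5) (by simp) fun N => (h.lintegral_min_le hα N).1

lemma integrable_inv [IsProbabilityMeasure ν] (h : IsSternBrocotLaw α ν)
    (hα : α ∈ Icc (3 / 4 : ℝ) 1) : Integrable (fun x => x⁻¹) ν :=
  integrable_of_lintegral_min_le measurable_inv (h.ae_pos.mono fun _ hx => (inv_pos.2 hx).le)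
    (C := 5) (by simp) fun N => (h.lintegral_min_le hα N).2

open Real (goldenRatio)

lemma inv_goldenRatio_eq : goldenRatio⁻¹ = goldenRatio - 1 := by
  refine inv_eq_of_mul_eq_one_right ?_
  linarith [Real.goldenRatio_sq]

/-- A Stern-Brocot law of parameter close to `1` is concentrated around the golden ratio. -/
lemma integral_abs_sub_goldenRatio_le [IsProbabilityMeasure ν] (h : IsSternBrocotLaw α ν)
    (hα : α ∈ Icc (3 / 4 : ℝ) 1) :
    ∫ x, |x - goldenRatio| ∂ν ≤ 16 * (1 - α) ∧
      ∫ x, |x⁻¹ - goldenRatio⁻¹| ∂ν ≤ 14 * (1 - α) := by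
  have hα' : α ∈ Icc (0 : ℝ) 1 := ⟨by linarith [hα.1], hα.2⟩
  have hφ1 := Real.one_lt_goldenRatio
  have hφ2 := Real.goldenRatio_lt_two
  have hφ := inv_goldenRatio_eq
  have hi₁ : Integrable (fun x => |x - goldenRatio|) ν :=
    ((h.integrable_id hα).sub (integrable_const _)).abs
  have hi₂ : Integrable (fun x => |x⁻¹ - goldenRatio⁻¹|) ν :=
    ((h.integrable_inv hα).sub (integrable_const _)).abs
  have h₁ := h.integral_le hα' (f := fun x => |x - goldenRatio|)
    (g₁ := fun x => |x⁻¹ - goldenRatio⁻¹|) (g₂ := fun _ => 2) (by fun_prop)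
    (fun _ => abs_nonneg _) hi₂ (integrable_const _)
    (fun x hx => by rw [hφ]; exact le_of_eq (congrArg _ (by ring)))
    (fun x hx => by
      have : (1 + x)⁻¹ ≤ 1 := inv_le_one_of_one_le₀ (by linarith)
      have : 0 < (1 + x)⁻¹ := by positivity
      rw [abs_le]
      constructor <;> linarith)
  have h₂ := h.integral_le hα' (f := fun x => |x⁻¹ - goldenRatio⁻¹|)
    (g₁ := fun x => 1 / 2 * |x - goldenRatio|) (g₂ := fun x => |x - goldenRatio| + 2)
    (by fun_prop)
    (fun _ => abs_nonneg _) (hi₁.const_mul _) (hi₁.add (integrable_const _))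
    (fun x hx => by
      have : (1 + x⁻¹)⁻¹ - goldenRatio⁻¹ =
          ((1 + x) * (1 + goldenRatio))⁻¹ * (x - goldenRatio) := by
        have h3 : goldenRatio⁻¹ = goldenRatio / (1 + goldenRatio) := by
          rw [inv_eq_one_div, div_eq_div_iff (by linarith) (by linarith)]
          linarith [Real.goldenRatio_sq]
        rw [h3]
        have : 1 + goldenRatio ≠ 0 := by linarith
        field_simp
        ring
      rw [this, abs_mul, abs_of_pos (by positivity)]
      gcongr
      rw [one_div]
      gcongr
      nlinarith)
    (fun x hx => by
      rw [inv_inv, hφ]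
      calc |1 + x - (goldenRatio - 1)| = |(x - goldenRatio) + 2| := congrArg _ (by ring)
        _ ≤ |x - goldenRatio| + |2| := abs_add_le _ _
        _ = |x - goldenRatio| + 2 := by norm_num)
  rw [integral_const_mul, integral_add hi₁ (integrable_const _)] at h₂
  simp only [integral_const, probReal_univ, one_smul] at h₁ h₂
  have hA : 0 ≤ ∫ x, |x - goldenRatio| ∂ν := integral_nonneg fun _ => abs_nonneg _
  have hB : 0 ≤ ∫ x, |x⁻¹ - goldenRatio⁻¹| ∂ν := integral_nonneg fun _ => abs_nonneg _
  have hAB := mul_le_mul_of_nonneg_right hα.2 hB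
  have hBA := mul_le_mul_of_nonneg_right hα.2 hA
  have hBA' := mul_le_mul_of_nonneg_right (show 1 - α ≤ 1 / 4 by linarith [hα.1]) hA
  constructor <;> nlinarith

lemma abs_log_le_add_inv {y : ℝ} (hy : 0 < y) : |Real.log y| ≤ y + y⁻¹ := by
  have h1 := Real.log_le_sub_one_of_pos hy
  have h2 := Real.log_le_sub_one_of_pos (inv_pos.2 hy)
  rw [Real.log_inv] at h2
  have := inv_pos.2 hy
  rw [abs_le]
  constructor <;> linarith

lemma abs_log_sub_log_le {m y z : ℝ} (hm : 0 < m) (hy : m ≤ y) (hz : m ≤ z) :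
    |Real.log y - Real.log z| ≤ m⁻¹ * |y - z| := by
  wlog hyz : z ≤ y generalizing y z
  · rw [abs_sub_comm, abs_sub_comm y]
    exact this hz hy (le_of_not_ge hyz)
  have hz' := hm.trans_le hz
  have hy' := hm.trans_le hy
  rw [abs_of_nonneg (sub_nonneg.2 (Real.log_le_log hz' hyz)), abs_of_nonneg (sub_nonneg.2 hyz),
    ← Real.log_div hy'.ne' hz'.ne']
  calc Real.log (y / z) ≤ y / z - 1 := Real.log_le_sub_one_of_pos (by positivity)
    _ = z⁻¹ * (y - z) := by field_simp
    _ ≤ m⁻¹ * (y - z) := by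
      gcongr

lemma log_goldenRatio_add_inv : Real.log (goldenRatio + goldenRatio⁻¹) = Real.log 5 / 2 := by
  rw [← Real.log_sqrt (by norm_num), inv_goldenRatio_eq, Real.goldenRatio]
  congr 1
  ring

/-- First order expansion of the logarithmic moment at `α = 1`. -/
lemma abs_integral_log_sub_le [IsProbabilityMeasure ν] (h : IsSternBrocotLaw α ν)
    (hα : α ∈ Icc (3 / 4 : ℝ) 1) :
    |∫ x, Real.log x ∂ν - (Real.log goldenRatio - (1 - α) * (Real.log 5 / 2))| ≤
      46 * (1 - α) ^ 2 := by
  have hα' : α ∈ Icc (0 : ℝ) 1 := ⟨by linarith [hα.1], hα.2⟩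
  have hφ1 := Real.one_lt_goldenRatio
  have hφ2 := Real.goldenRatio_lt_two
  have hφ := inv_goldenRatio_eq
  have hφpos : 0 < goldenRatio⁻¹ := by positivity
  have hlog {f : ℝ → ℝ} (hf : Measurable f) {g : ℝ → ℝ} (hg : Integrable g ν)
      (hfg : ∀ x, 0 < x → 0 < f x ∧ f x + (f x)⁻¹ ≤ g x) :
      Integrable (fun x => Real.log (f x)) ν := by
    refine hg.mono' (Real.measurable_log.comp hf).aestronglyMeasurable ?_
    filter_upwards [h.ae_pos] with x hx
    exact (abs_log_le_add_inv (hfg x hx).1).trans (hfg x hx).2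
  have hid := h.integrable_id hα
  have hinv := h.integrable_inv hα
  have hi : Integrable (fun x => Real.log (x + goldenRatio⁻¹)) ν := by
    refine hlog (by fun_prop) (g := fun x => x + (goldenRatio⁻¹ + goldenRatio))
      (hid.add (integrable_const _)) fun x hx => ⟨by positivity, ?_⟩
    have : (x + goldenRatio⁻¹)⁻¹ ≤ goldenRatio := by
      rw [inv_le_comm₀ (by positivity) (by positivity)]
      linarith
    linarith
  have hi₁ : Integrable (fun x => Real.log (1 + x⁻¹ + goldenRatio⁻¹)) ν := by
    refine hlog (by fun_prop) (g := fun x => x⁻¹ + (2 + goldenRatio⁻¹))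
      (hinv.add (integrable_const _)) fun x hx => ⟨by positivity, ?_⟩
    have : 0 < x⁻¹ := by positivity
    have : (1 + x⁻¹ + goldenRatio⁻¹)⁻¹ ≤ 1 := inv_le_one_of_one_le₀ (by linarith)
    linarith
  have hi₂ : Integrable (fun x => Real.log ((1 + x)⁻¹ + goldenRatio⁻¹)) ν := by
    refine hlog (by fun_prop) (g := fun x => 1 + (goldenRatio⁻¹ + goldenRatio))
      (integrable_const _) fun x hx => ⟨by positivity, ?_⟩
    have h1 : (1 + x)⁻¹ ≤ 1 := inv_le_one_of_one_le₀ (by linarith)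
    have : ((1 + x)⁻¹ + goldenRatio⁻¹)⁻¹ ≤ goldenRatio := by
      rw [inv_le_comm₀ (by positivity) (by positivity)]
      have : 0 < (1 + x)⁻¹ := by positivity
      linarith
    linarith
  have hstat := h.integral_eq hα' (f := fun x => Real.log (x + goldenRatio⁻¹)) (by fun_prop) hi₁ hi₂
  have hdecomp : ∫ x, Real.log x ∂ν =
      ∫ x, Real.log (x + goldenRatio⁻¹) ∂ν - ∫ x, Real.log (1 + x⁻¹ + goldenRatio⁻¹) ∂ν +
        Real.log goldenRatio := by
    have : ∫ x, Real.log x ∂ν = ∫ x, (Real.log (x + goldenRatio⁻¹) -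
        Real.log (1 + x⁻¹ + goldenRatio⁻¹) + Real.log goldenRatio) ∂ν := by
      refine integral_congr_ae ?_
      filter_upwards [h.ae_pos] with x hx
      have hy : 0 < 1 + x⁻¹ + goldenRatio⁻¹ := by positivity
      have key : x * (1 + x⁻¹ + goldenRatio⁻¹) = (x + goldenRatio⁻¹) * goldenRatio := by
        rw [add_mul, inv_mul_cancel₀ (by positivity), hφ]
        field_simp
        ring
      have := congrArg Real.log key
      rw [Real.log_mul hx.ne' hy.ne', Real.log_mul (by positivity) (by positivity)] at this
      linarith
    rw [this, integral_add (f := fun x => Real.log (x + goldenRatio⁻¹) -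
      Real.log (1 + x⁻¹ + goldenRatio⁻¹)) (hi.sub hi₁) (integrable_const _), integral_sub hi hi₁]
    simp
  have habs {f : ℝ → ℝ} (hf : Integrable f ν) {c : ℝ} {g : ℝ → ℝ} (hg : Integrable g ν)
      (hfg : ∀ x, 0 < x → |f x - c| ≤ g x) : |∫ x, f x ∂ν - c| ≤ ∫ x, g x ∂ν := by
    have : ∫ x, f x ∂ν - c = ∫ x, (f x - c) ∂ν := by
      rw [integral_sub hf (integrable_const _)]
      simp
    rw [this]
    exact norm_integral_le_of_norm_le (f := fun x => f x - c) hg (h.ae_pos.mono hfg)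
  have hA := habs hi₂ (c := 0) (g := fun x => 2 * |x - goldenRatio|)
    ((hid.sub (integrable_const _)).abs.const_mul _) fun x hx => by
      have h1 : goldenRatio⁻¹ = 1 - (1 + goldenRatio)⁻¹ := by
        have : (1 + goldenRatio)⁻¹ = 2 - goldenRatio := by
          refine inv_eq_of_mul_eq_one_right ?_
          linarith [Real.goldenRatio_sq]
        linarith
      have h2 : (1 / 2 : ℝ) ≤ goldenRatio⁻¹ := by
        rw [one_div]
        gcongr
      have h3 : 0 < (1 + x)⁻¹ := by positivity
      have h4 := abs_log_sub_log_le (m := 1 / 2) (y := (1 + x)⁻¹ + goldenRatio⁻¹) (z := 1)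
        (by norm_num) (by linarith) (by norm_num)
      rw [Real.log_one] at h4
      refine h4.trans ?_
      rw [one_div, inv_inv]
      gcongr 2 * ?_
      have h5 : (1 + x)⁻¹ + goldenRatio⁻¹ - 1 =
          -(((1 + x) * (1 + goldenRatio))⁻¹ * (x - goldenRatio)) := by
        rw [h1]
        have : 1 + goldenRatio ≠ 0 := by linarith
        field_simp
        ring
      rw [h5, abs_neg, abs_mul, abs_of_pos (by positivity)]
      refine mul_le_of_le_one_left (abs_nonneg _) (inv_le_one_of_one_le₀ ?_)
      nlinarith
  have hB := habs hi₁ (c := Real.log 5 / 2) (g := fun x => |x⁻¹ - goldenRatio⁻¹|)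
    (hinv.sub (integrable_const _)).abs fun x hx => by
      rw [← log_goldenRatio_add_inv]
      have h3 : 0 < x⁻¹ := by positivity
      have h4 := abs_log_sub_log_le (m := 1) (y := 1 + x⁻¹ + goldenRatio⁻¹)
        (z := goldenRatio + goldenRatio⁻¹) one_pos (by linarith) (by linarith)
      refine h4.trans (le_of_eq ?_)
      rw [inv_one, one_mul]
      congr 1
      rw [hφ]
      ring
  rw [integral_const_mul] at hA
  obtain ⟨hA', hB'⟩ := h.integral_abs_sub_goldenRatio_le hα
  have hε : 0 ≤ 1 - α := by linarith [hα.2]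
  have heq : ∫ x, Real.log x ∂ν - (Real.log goldenRatio - (1 - α) * (Real.log 5 / 2)) =
      (1 - α) * ((∫ x, Real.log ((1 + x)⁻¹ + goldenRatio⁻¹) ∂ν - 0) -
        (∫ x, Real.log (1 + x⁻¹ + goldenRatio⁻¹) ∂ν - Real.log 5 / 2)) := by
    rw [hdecomp, hstat]
    ring
  rw [heq, abs_mul, abs_of_nonneg hε, pow_two, mul_left_comm]
  gcongr
  refine (abs_sub _ _).trans ?_
  linarith

end IsSternBrocotLaw

/-- The parameter `α̃(p)` has derivative `1` at `p = 1`. -/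
lemma hasDerivAt_alphaTilde :
    HasDerivAt (fun p : ℝ => 2 * p / (p + Real.sqrt (p * (4 - 3 * p)))) 1 1 := by
  have h1 : HasDerivAt (fun p : ℝ => p * (4 - 3 * p)) (-2) 1 := by
    have := (hasDerivAt_id (1 : ℝ)).mul (((hasDerivAt_id (1 : ℝ)).const_mul 3).const_sub 4)
    refine HasDerivAt.congr_deriv (f := fun p : ℝ => p * (4 - 3 * p)) this ?_
    norm_num
  have h2 := h1.sqrt (by norm_num)
  have h3 := ((hasDerivAt_id (1 : ℝ)).const_mul 2).div ((hasDerivAt_id (1 : ℝ)).add h2)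
    (by norm_num)
  refine HasDerivAt.congr_deriv
    (f := fun p : ℝ => 2 * p / (p + Real.sqrt (p * (4 - 3 * p)))) h3 ?_
  norm_num

lemma alphaTilde_le_one {p : ℝ} (hp : p ∈ Ioc (1 / 3 : ℝ) 1) :
    2 * p / (p + Real.sqrt (p * (4 - 3 * p))) ≤ 1 := by
  have hp0 : 0 < p := by linarith [hp.1]
  rw [div_le_one (by positivity)]
  have : p ≤ Real.sqrt (p * (4 - 3 * p)) := Real.le_sqrt_of_sq_le (by nlinarith [hp.2])
  linarith

/-- The map `p ↦ γ̃_p = ∫ log x dν_{α̃(p)}(x)`, with `α̃(p) = 2p/(p + √(p(4 - 3p)))`,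
has derivative `(log 5)/2` at `p = 1` within `(1/3,1]`. -/
theorem gammaTilde_hasDerivWithinAt_one
    (ν : ℝ → Measure ℝ) (hν : ∀ α ∈ Set.Icc (0 : ℝ) 1, IsSternBrocotMeasure α (ν α)) :
    HasDerivWithinAt (fun p : ℝ =>
        ∫ x, Real.log x ∂(ν (2 * p / (p + Real.sqrt (p * (4 - 3 * p))))))
      (Real.log 5 / 2) (Set.Ioc (1 / 3) 1) 1 := by
  set a : ℝ → ℝ := fun p => 2 * p / (p + Real.sqrt (p * (4 - 3 * p))) with ha
  have ha1 : a 1 = 1 := by norm_num [ha]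
  have hda : HasDerivWithinAt a 1 (Ioc (1 / 3) 1) 1 := hasDerivAt_alphaTilde.hasDerivWithinAt
  set F : ℝ → ℝ := fun p => ∫ x, Real.log x ∂(ν (a p)) with hF
  set G : ℝ → ℝ := fun p => Real.log Real.goldenRatio - (1 - a p) * (Real.log 5 / 2) with hG
  have hbound {p : ℝ} (hp : a p ∈ Icc (3 / 4 : ℝ) 1) : |F p - G p| ≤ 46 * (1 - a p) ^ 2 := by
    have hp' : a p ∈ Icc (0 : ℝ) 1 := ⟨by linarith [hp.1], hp.2⟩
    have := (hν _ hp').1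
    exact ((hν _ hp').isSternBrocotLaw hp').abs_integral_log_sub_le hp
  have hFG1 : F 1 - G 1 = 0 := by
    have := hbound (p := 1) (by rw [ha1]; norm_num)
    rw [ha1] at this
    simpa using this
  have hGd : HasDerivWithinAt G (Real.log 5 / 2) (Ioc (1 / 3) 1) 1 := by
    simpa using ((hda.const_sub 1).mul_const (Real.log 5 / 2)).const_sub (Real.log Real.goldenRatio)
  have hFGd : HasDerivWithinAt (fun p => F p - G p) 0 (Ioc (1 / 3) 1) 1 := by
    rw [hasDerivWithinAt_iff_isLittleO]
    simp only [hFG1, sub_zero, smul_zero]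
    have h1 : (fun p => F p - G p) =O[𝓝[Ioc (1 / 3) 1] 1] fun p => (1 - a p) ^ 2 := by
      refine Asymptotics.IsBigO.of_bound 46 ?_
      filter_upwards [self_mem_nhdsWithin, hda.continuousWithinAt.eventually
        (lt_mem_nhds (show (3 / 4 : ℝ) < a 1 by rw [ha1]; norm_num))] with p hp hp'
      rw [Real.norm_eq_abs, Real.norm_of_nonneg (sq_nonneg _)]
      exact hbound ⟨hp'.le, alphaTilde_le_one hp⟩
    have h2 : (fun p => 1 - a p) =O[𝓝[Ioc (1 / 3) 1] 1] fun p => p - 1 := by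
      have := hda.hasFDerivWithinAt.isBigO_sub
      rw [ha1] at this
      simpa using this.neg_left
    have h3 : (fun p : ℝ => p - 1) =o[𝓝[Ioc (1 / 3) 1] 1] fun _ => (1 : ℝ) := by
      rw [Asymptotics.isLittleO_one_iff]
      exact tendsto_nhdsWithin_of_tendsto_nhds
        ((continuous_id.sub continuous_const).tendsto' _ _ (by simp))
    refine h1.trans_isLittleO ((h2.pow 2).trans_isLittleO ?_)
    simpa [pow_two] using (Asymptotics.isBigO_refl (fun p : ℝ => p - 1) _).mul_isLittleO h3
  have hF' : HasDerivWithinAt (fun p => F p - G p + G p) (0 + Real.log 5 / 2) (Ioc (1 / 3) 1) 1 :=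
    hFGd.add hGd
  simpa only [sub_add_cancel, zero_add] using hF'
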